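/- arXiv:1411.0161 — 5 statements merged into one kernel-verified Lean document; each statement's English description precedes it below -/
import Mathlib

section
/- Let x_1, …, x_n ∈ ℝ^d (n ≥ 1), σ > 0, and let P̂(x) = (1/n) Σ_{j=1}^n (√π σ)^{−d} exp(−‖x − x_j‖²/σ²) be the Gaussian Parzen estimator. Suppose the Gaussian-kernel dictionary is γ-Babel, i.e. Σ_{j≠i} exp(−‖x_i − x_j‖²/(2σ²)) ≤ γ for every i. Then the estimated quadratic Rényi entropy H₂ = −log ∫_{ℝ^d} P̂(x)² dx satisfies H₂ ≥ (d/2) log(2πσ²) + log n − log(1 + γ). -/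
open MeasureTheory Real

lemma aux_mul {d : ℕ} (a b x : EuclideanSpace ℝ (Fin d)) (σ : ℝ) (hσ : 0 < σ) :
    Real.exp (-‖x - a‖ ^ 2 / σ ^ 2) * Real.exp (-‖x - b‖ ^ 2 / σ ^ 2) =
      Real.exp (-‖a - b‖ ^ 2 / (2 * σ ^ 2)) *
        Real.exp (-(2 / σ ^ 2) * ‖x - (1 / 2 : ℝ) • (a + b)‖ ^ 2) := by
  rw [← Real.exp_add, ← Real.exp_add]
  congr 1
  have h1 := parallelogram_law_with_norm ℝ (x - a) (x - b)
  have e1 : (x - a) + (x - b) = (2 : ℝ) • (x - (1 / 2 : ℝ) • (a + b)) := by module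
  have e2 : (x - a) - (x - b) = -(a - b) := by abel
  rw [e1, e2, norm_neg, norm_smul] at h1
  norm_num at h1
  have hs : σ ≠ 0 := hσ.ne'
  field_simp
  norm_num
  nlinarith [h1]

lemma aux_int {d : ℕ} (m : EuclideanSpace ℝ (Fin d)) (σ : ℝ) (hσ : 0 < σ) :
    ∫ x : EuclideanSpace ℝ (Fin d), Real.exp (-(2 / σ ^ 2) * ‖x - m‖ ^ 2) =
      (π / (2 / σ ^ 2)) ^ ((d : ℝ) / 2) := by
  rw [integral_sub_right_eq_self
    (fun x : EuclideanSpace ℝ (Fin d) => Real.exp (-(2 / σ ^ 2) * ‖x‖ ^ 2)) m,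
    GaussianFourier.integral_rexp_neg_mul_sq_norm (by positivity)]
  simp

lemma aux_integrable {d : ℕ} (m : EuclideanSpace ℝ (Fin d)) (σ : ℝ) (hσ : 0 < σ) :
    Integrable (fun x : EuclideanSpace ℝ (Fin d) =>
      Real.exp (-(2 / σ ^ 2) * ‖x - m‖ ^ 2)) := by
  apply Integrable.of_integral_ne_zero
  rw [aux_int m σ hσ]
  have : 0 < π := Real.pi_pos
  positivity

/-- For a `γ`-Babel Gaussian-kernel dictionary, the estimated quadratic Rényi entropy is
lower-bounded by `(d/2) log(2πσ²) + log n − log(1 + γ)`. -/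
theorem quadratic_entropy_lower_bound_babel (d n : ℕ) (hn : 1 ≤ n)
    (X : Fin n → EuclideanSpace ℝ (Fin d)) (σ γ : ℝ) (hσ : 0 < σ)
    (hbabel : ∀ i, ∑ j ∈ Finset.univ.erase i,
        Real.exp (-‖X i - X j‖ ^ 2 / (2 * σ ^ 2)) ≤ γ) :
    (d : ℝ) / 2 * Real.log (2 * π * σ ^ 2) + Real.log n - Real.log (1 + γ) ≤
      -Real.log (∫ x : EuclideanSpace ℝ (Fin d),
        ((1 / (n : ℝ)) * ∑ j, ((Real.sqrt π * σ) ^ d)⁻¹ *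
          Real.exp (-‖x - X j‖ ^ 2 / σ ^ 2)) ^ 2) := by
  have hpi : 0 < π := Real.pi_pos
  have hn0 : (0 : ℝ) < n := by exact_mod_cast hn
  set S : ℝ := ∑ i, ∑ j, Real.exp (-‖X i - X j‖ ^ 2 / (2 * σ ^ 2)) with hS
  set C : ℝ := ((1 / (n : ℝ)) * ((Real.sqrt π * σ) ^ d)⁻¹) ^ 2 with hC
  have hfun : ∀ x : EuclideanSpace ℝ (Fin d),
      ((1 / (n : ℝ)) * ∑ j, ((Real.sqrt π * σ) ^ d)⁻¹ *
          Real.exp (-‖x - X j‖ ^ 2 / σ ^ 2)) ^ 2 =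
      C * ∑ i, ∑ j, Real.exp (-‖X i - X j‖ ^ 2 / (2 * σ ^ 2)) *
        Real.exp (-(2 / σ ^ 2) * ‖x - (1 / 2 : ℝ) • (X i + X j)‖ ^ 2) := by
    intro x
    simp_rw [← aux_mul _ _ x σ hσ]
    rw [← Finset.sum_mul_sum, ← Finset.mul_sum, hC]
    ring
  have hint : (∫ x : EuclideanSpace ℝ (Fin d),
        ((1 / (n : ℝ)) * ∑ j, ((Real.sqrt π * σ) ^ d)⁻¹ *
          Real.exp (-‖x - X j‖ ^ 2 / σ ^ 2)) ^ 2) =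
      C * (S * (π / (2 / σ ^ 2)) ^ ((d : ℝ) / 2)) := by
    simp_rw [hfun]
    rw [integral_const_mul, integral_finsetSum]
    · congr 1
      rw [hS, Finset.sum_mul]
      refine Finset.sum_congr rfl fun i _ => ?_
      rw [integral_finsetSum, Finset.sum_mul]
      · refine Finset.sum_congr rfl fun j _ => ?_
        rw [integral_const_mul, aux_int _ σ hσ]
      · exact fun j _ => (aux_integrable _ σ hσ).const_mul _
    · exact fun i _ => integrable_finsetSum _ fun j _ =>
        (aux_integrable _ σ hσ).const_mul _
  have hSle : S ≤ n * (1 + γ) := by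
    have : ∀ i ∈ Finset.univ, ∑ j, Real.exp (-‖X i - X j‖ ^ 2 / (2 * σ ^ 2)) ≤ 1 + γ := by
      intro i _
      rw [← Finset.add_sum_erase _ _ (Finset.mem_univ i)]
      have h0 : Real.exp (-‖X i - X i‖ ^ 2 / (2 * σ ^ 2)) = 1 := by simp
      rw [h0]
      linarith [hbabel i]
    have h2 := Finset.sum_le_sum this
    simpa [hS, mul_add] using h2
  have hSpos : 0 < S := by
    have i0 : Fin n := ⟨0, hn⟩
    have : Nonempty (Fin n) := ⟨i0⟩
    exact Finset.sum_pos (fun i _ => Finset.sum_pos (fun j _ => Real.exp_pos _)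
      Finset.univ_nonempty) Finset.univ_nonempty
  have hγ : 0 < 1 + γ := by
    by_contra h
    push Not at h
    nlinarith
  have hlogS : Real.log S ≤ Real.log n + Real.log (1 + γ) := by
    rw [← Real.log_mul hn0.ne' hγ.ne']
    exact Real.log_le_log hSpos hSle
  have hCpos : 0 < C := by positivity
  have hs2 : Real.log (σ ^ 2) = 2 * Real.log σ := by rw [Real.log_pow]; norm_num
  have hlC : Real.log C = 2 * (-Real.log n - d * (Real.log π / 2 + Real.log σ)) := by
    rw [hC, Real.log_pow, Real.log_mul (by positivity) (by positivity), Real.log_inv,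
      Real.log_pow, Real.log_mul (by positivity) (by positivity), Real.log_sqrt hpi.le,
      one_div, Real.log_inv]
    push_cast
    ring
  have hl1 : Real.log (2 * π * σ ^ 2) = Real.log 2 + Real.log π + 2 * Real.log σ := by
    rw [Real.log_mul (by positivity) (by positivity),
      Real.log_mul (by positivity) (by positivity), hs2]
  have hl2 : Real.log (π / (2 / σ ^ 2)) = Real.log π - (Real.log 2 - 2 * Real.log σ) := by
    rw [Real.log_div (by positivity) (by positivity),
      Real.log_div (by positivity) (by positivity), hs2]
  rw [hint, Real.log_mul hCpos.ne' (by positivity), Real.log_mul hSpos.ne' (by positivity),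
    Real.log_rpow (by positivity), hlC, hl1, hl2]
  nlinarith [hlogS]
end

section
/- Let v_1, …, v_n be nonzero vectors in a real inner product space with ‖v_i‖ ≤ R for all i, and suppose the family is δ-distant, i.e. ‖v_i‖² − ⟪v_i, v_j⟫²/‖v_j‖² ≥ δ² for all i ≠ j (δ ≥ 0). Then Σ_{i=1}^n Σ_{j=1}^n ⟪v_i, v_j⟫ ≤ n (R² + (n−1) R √(R² − δ²)); consequently, if this double sum is positive, the estimated quadratic entropy satisfies −log( (1/n²) Σ_{i,j} ⟪v_i, v_j⟫ ) ≥ log n − log( R² + (n−1) R √(R² − δ²) ). -/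
open RealInnerProductSpace

/-- For a `δ`-distant dictionary of nonzero atoms with norms bounded by `R`, the Gram-matrix
sum is at most `n(R² + (n−1)R√(R² − δ²))`; consequently the estimated quadratic entropy
`−log((1/n²)∑ᵢⱼ⟪vᵢ,vⱼ⟫)` is at least `log n − log(R² + (n−1)R√(R² − δ²))`. -/
theorem quadratic_entropy_lower_bound_distant_kernel {H : Type*} [NormedAddCommGroup H]
    [InnerProductSpace ℝ H] (n : ℕ) (v : Fin n → H) (R δ : ℝ) (hδ : 0 ≤ δ)
    (hv : ∀ i, v i ≠ 0) (hR : ∀ i, ‖v i‖ ≤ R)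
    (hdist : ∀ i j, i ≠ j → δ ^ 2 ≤ ‖v i‖ ^ 2 - ⟪v i, v j⟫ ^ 2 / ‖v j‖ ^ 2) :
    (∑ i, ∑ j, ⟪v i, v j⟫)
        ≤ n * (R ^ 2 + ((n : ℝ) - 1) * R * Real.sqrt (R ^ 2 - δ ^ 2)) ∧
    (0 < ∑ i, ∑ j, ⟪v i, v j⟫ →
      Real.log n - Real.log (R ^ 2 + ((n : ℝ) - 1) * R * Real.sqrt (R ^ 2 - δ ^ 2)) ≤
        -Real.log ((1 / (n : ℝ) ^ 2) * ∑ i, ∑ j, ⟪v i, v j⟫)) := by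
  have key : (∑ i, ∑ j, ⟪v i, v j⟫)
        ≤ n * (R ^ 2 + ((n : ℝ) - 1) * R * Real.sqrt (R ^ 2 - δ ^ 2)) := by
    set C := R * Real.sqrt (R ^ 2 - δ ^ 2) with hC
    have hterm : ∀ i j, ⟪v i, v j⟫ ≤ C + if i = j then R ^ 2 - C else 0 := by
      intro i j
      have hR0 : 0 ≤ R := (norm_nonneg _).trans (hR i)
      split_ifs with h
      · subst h
        rw [real_inner_self_eq_norm_sq]
        have := pow_le_pow_left₀ (norm_nonneg _) (hR i) 2
        linarith
      · have hj : 0 < ‖v j‖ ^ 2 := by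
          have := norm_pos_iff.mpr (hv j)
          positivity
        have h1 := hdist i j h
        have hi2 := pow_le_pow_left₀ (norm_nonneg _) (hR i) 2
        have hj2 := pow_le_pow_left₀ (norm_nonneg _) (hR j) 2
        have h2 : ⟪v i, v j⟫ ^ 2 / ‖v j‖ ^ 2 ≤ R ^ 2 - δ ^ 2 := by linarith
        have h0 : 0 ≤ R ^ 2 - δ ^ 2 := le_trans (by positivity) h2
        rw [div_le_iff₀ hj] at h2
        have h3 : ⟪v i, v j⟫ ^ 2 ≤ C ^ 2 := by
          rw [hC, mul_pow, Real.sq_sqrt h0]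
          nlinarith [mul_le_mul_of_nonneg_left hj2 h0]
        have hC0 : 0 ≤ C := by positivity
        have := abs_le_of_sq_le_sq h3 hC0
        linarith [le_abs_self ⟪v i, v j⟫]
    calc (∑ i, ∑ j, ⟪v i, v j⟫)
        ≤ ∑ i : Fin n, ∑ j : Fin n, (C + if i = j then R ^ 2 - C else 0) :=
          Finset.sum_le_sum fun i _ => Finset.sum_le_sum fun j _ => hterm i j
      _ = n * (R ^ 2 + ((n : ℝ) - 1) * R * Real.sqrt (R ^ 2 - δ ^ 2)) := by
          simp [Finset.sum_add_distrib]
          rw [hC]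
          ring
  refine ⟨key, fun hpos => ?_⟩
  have hn : (0 : ℝ) < n := by
    rcases Nat.eq_zero_or_pos n with h | h
    · subst h
      simp at hpos
    · exact_mod_cast h
  generalize (∑ i, ∑ j, ⟪v i, v j⟫) = S at *
  generalize R ^ 2 + ((n : ℝ) - 1) * R * Real.sqrt (R ^ 2 - δ ^ 2) = B at *
  have hB : 0 < B := pos_of_mul_pos_right (hpos.trans_le key) hn.le
  have hl := Real.log_le_log hpos key
  rw [Real.log_mul hn.ne' hB.ne'] at hl
  rw [Real.log_mul (by positivity) hpos.ne', one_div, Real.log_inv, Real.log_pow]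
  push_cast
  linarith
end

section
/- Let v_1, …, v_n be nonzero vectors in a real inner product space with ‖v_i‖ ≤ R for all i, and suppose the family is γ-coherent, i.e. |⟪v_i, v_j⟫| ≤ γ‖v_i‖‖v_j‖ for all i ≠ j (γ ≥ 0). Then Σ_{i=1}^n Σ_{j=1}^n ⟪v_i, v_j⟫ ≤ n (R² + (n−1) γ R²); consequently, if this double sum is positive, the estimated quadratic entropy satisfies −log( (1/n²) Σ_{i,j} ⟪v_i, v_j⟫ ) ≥ log n − log( R² + (n−1) γ R² ). -/
open RealInnerProductSpace

/-- For a `γ`-coherent dictionary of nonzero atoms with norms bounded by `R`, the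
Gram-matrix sum is at most `n(R² + (n−1)γR²)`; consequently the estimated quadratic entropy
`−log((1/n²)∑ᵢⱼ⟪vᵢ,vⱼ⟫)` is at least `log n − log(R² + (n−1)γR²)`. -/
theorem quadratic_entropy_lower_bound_coherent_kernel {H : Type*} [NormedAddCommGroup H]
    [InnerProductSpace ℝ H] (n : ℕ) (v : Fin n → H) (R γ : ℝ) (hγ : 0 ≤ γ)
    (hv : ∀ i, v i ≠ 0) (hR : ∀ i, ‖v i‖ ≤ R)
    (hcoh : ∀ i j, i ≠ j → |⟪v i, v j⟫| ≤ γ * ‖v i‖ * ‖v j‖) :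
    (∑ i, ∑ j, ⟪v i, v j⟫) ≤ n * (R ^ 2 + ((n : ℝ) - 1) * γ * R ^ 2) ∧
    (0 < ∑ i, ∑ j, ⟪v i, v j⟫ →
      Real.log n - Real.log (R ^ 2 + ((n : ℝ) - 1) * γ * R ^ 2) ≤
        -Real.log ((1 / (n : ℝ) ^ 2) * ∑ i, ∑ j, ⟪v i, v j⟫)) := by
  have h1 : (∑ i, ∑ j, ⟪v i, v j⟫) ≤ n * (R ^ 2 + ((n : ℝ) - 1) * γ * R ^ 2) := by
    have key : ∀ i j, ⟪v i, v j⟫ ≤ γ * R ^ 2 + if i = j then R ^ 2 - γ * R ^ 2 else 0 := by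
      intro i j
      have hi := norm_nonneg (v i)
      have hj := norm_nonneg (v j)
      have hm : ‖v i‖ * ‖v j‖ ≤ R ^ 2 := by
        rw [sq]
        exact mul_le_mul (hR i) (hR j) hj (hi.trans (hR i))
      split_ifs with h
      · have := real_inner_le_norm (v i) (v j)
        linarith
      · have h2 := (le_abs_self _).trans (hcoh i j h)
        have h3 := mul_le_mul_of_nonneg_left hm hγ
        rw [← mul_assoc] at h3
        linarith
    calc (∑ i, ∑ j, ⟪v i, v j⟫)
        ≤ ∑ i : Fin n, ∑ j : Fin n, (γ * R ^ 2 + if i = j then R ^ 2 - γ * R ^ 2 else 0) :=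
          Finset.sum_le_sum fun i _ => Finset.sum_le_sum fun j _ => key i j
      _ = n * (R ^ 2 + ((n : ℝ) - 1) * γ * R ^ 2) := by
          simp [Finset.sum_add_distrib]
          ring
  refine ⟨h1, fun hS => ?_⟩
  have hn : (0 : ℝ) < n := by
    rcases Nat.eq_zero_or_pos n with h | h
    · subst h
      simp at hS
    · exact_mod_cast h
  have hB : 0 < R ^ 2 + ((n : ℝ) - 1) * γ * R ^ 2 :=
    pos_of_mul_pos_right (hS.trans_le h1) hn.le
  have h4 : (1 / (n : ℝ) ^ 2) * ∑ i, ∑ j, ⟪v i, v j⟫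
      ≤ (R ^ 2 + ((n : ℝ) - 1) * γ * R ^ 2) / n := by
    calc _ ≤ (1 / (n : ℝ) ^ 2) * (n * (R ^ 2 + ((n : ℝ) - 1) * γ * R ^ 2)) :=
          mul_le_mul_of_nonneg_left h1 (by positivity)
      _ = _ := by field_simp
  have h5 := Real.log_le_log (mul_pos (by positivity) hS) h4
  rw [Real.log_div hB.ne' hn.ne'] at h5
  linarith
end

section
/- Let v_1, …, v_n be vectors in a real inner product space with ‖v_i‖ ≤ R for all i, and suppose the family is γ-Babel, i.e. Σ_{j≠i} |⟪v_i, v_j⟫| ≤ γ for every i. Then Σ_{i=1}^n Σ_{j=1}^n ⟪v_i, v_j⟫ ≤ n (R² + γ); consequently, if this double sum is positive, the estimated quadratic entropy satisfies −log( (1/n²) Σ_{i,j} ⟪v_i, v_j⟫ ) ≥ log n − log( R² + γ ). -/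
open RealInnerProductSpace

/-- For a `γ`-Babel dictionary with atom norms bounded by `R`, the Gram-matrix sum is at
most `n(R² + γ)`; consequently the estimated quadratic entropy
`−log((1/n²)∑ᵢⱼ⟪vᵢ,vⱼ⟫)` is at least `log n − log(R² + γ)`. -/
theorem quadratic_entropy_lower_bound_babel_kernel {H : Type*} [NormedAddCommGroup H]
    [InnerProductSpace ℝ H] (n : ℕ) (v : Fin n → H) (R γ : ℝ)
    (hR : ∀ i, ‖v i‖ ≤ R)
    (hbabel : ∀ i, ∑ j ∈ Finset.univ.erase i, |⟪v i, v j⟫| ≤ γ) :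
    (∑ i, ∑ j, ⟪v i, v j⟫) ≤ n * (R ^ 2 + γ) ∧
    (0 < ∑ i, ∑ j, ⟪v i, v j⟫ →
      Real.log n - Real.log (R ^ 2 + γ) ≤
        -Real.log ((1 / (n : ℝ) ^ 2) * ∑ i, ∑ j, ⟪v i, v j⟫)) := by
  have h1 : (∑ i, ∑ j, ⟪v i, v j⟫) ≤ n * (R ^ 2 + γ) := by
    have h : ∀ i ∈ (Finset.univ : Finset (Fin n)), (∑ j, ⟪v i, v j⟫) ≤ R ^ 2 + γ := by
      intro i _
      rw [← Finset.add_sum_erase _ _ (Finset.mem_univ i)]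
      have ha : ⟪v i, v i⟫ ≤ R ^ 2 := by
        rw [real_inner_self_eq_norm_sq]
        exact pow_le_pow_left₀ (norm_nonneg _) (hR i) 2
      have hb : ∑ j ∈ Finset.univ.erase i, ⟪v i, v j⟫ ≤ γ :=
        (Finset.sum_le_sum fun j _ => le_abs_self _).trans (hbabel i)
      exact add_le_add ha hb
    have h2 := Finset.sum_le_card_nsmul _ _ _ h
    simpa [mul_add] using h2
  refine ⟨h1, fun hpos => ?_⟩
  generalize (∑ i, ∑ j, ⟪v i, v j⟫) = S at h1 hpos
  have hn : (0 : ℝ) < n := by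
    rcases Nat.eq_zero_or_pos n with h0 | h0
    · subst h0
      simp at h1
      linarith
    · exact_mod_cast h0
  have hc : 0 < R ^ 2 + γ := pos_of_mul_pos_right (hpos.trans_le h1) hn.le
  have hl := Real.log_le_log hpos h1
  rw [Real.log_mul hn.ne' hc.ne'] at hl
  rw [Real.log_mul (by positivity) hpos.ne', one_div, Real.log_inv, Real.log_pow]
  push_cast
  linarith
end

section
/- Let g : ℝ → ℝ be infinitely differentiable on [0, ∞) and completely monotonic there, i.e. (−1)^k g^(k)(t) ≥ 0 for every integer k ≥ 0 and every t ≥ 0. Then the kernel κ(x, y) = g(‖x − y‖²) on ℝ^d is positive definite: for any points x_1, …, x_n ∈ ℝ^d and any real coefficients c_1, …, c_n, Σ_{i=1}^n Σ_{j=1}^n c_i c_j g(‖x_i − x_j‖²) ≥ 0. -/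
open scoped Nat in
lemma cm_taylor (g : ℝ → ℝ)
    (hg : ContDiffOn ℝ (⊤ : ℕ∞) g (Set.Ici 0))
    (hmono : ∀ k : ℕ, ∀ t ∈ Set.Ici (0 : ℝ),
        0 ≤ (-1 : ℝ) ^ k * iteratedDerivWithin k g (Set.Ici 0) t)
    (R : ℝ) (hR : 0 < R) (a : ℕ → ℝ)
    (ha : a = fun k => R ^ k / k ! * ((-1) ^ k * iteratedDerivWithin k g (Set.Ici 0) R))
    (n : ℕ) :
    (∑ k ∈ Finset.range (n + 1), a k ≤ g 0) ∧
    ∀ x, 0 ≤ x → x ≤ R →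
      |g x - ∑ k ∈ Finset.range (n + 1), a k * (1 - x / R) ^ k| ≤ (1 - x / R) ^ n * g 0 := by
  set s : Set ℝ := Set.Ici 0 with hs
  have hu : UniqueDiffOn ℝ s := uniqueDiffOn_Ici 0
  have hder : ∀ x : ℝ, ∀ y ∈ s, HasDerivWithinAt (fun t => g x - taylorWithinEval g n s t x)
      ((y - x) ^ n / n ! * ((-1) ^ (n + 1) * iteratedDerivWithin (n + 1) g s y)) s y := by
    intro x y hy
    have h1 := hasDerivWithinAt_taylorWithinEval (f := g) (x := x) (y := y) (n := n) hu
      self_mem_nhdsWithin hy subset_rfl (hg.of_le (by exact_mod_cast le_top))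
      (hg.differentiableOn_iteratedDerivWithin (by exact_mod_cast WithTop.coe_lt_top _) hu y hy)
    refine (h1.const_sub (g x)).congr_deriv ?_
    have : (x - y) ^ n = (-1) ^ n * (y - x) ^ n := by rw [← mul_pow]; ring
    rw [this, smul_eq_mul]
    ring
  have hT : ∀ x, taylorWithinEval g n s R x
      = ∑ k ∈ Finset.range (n + 1), a k * (1 - x / R) ^ k := by
    intro x
    rw [taylor_within_apply]
    refine Finset.sum_congr rfl fun k _ => ?_
    have : (x - R) ^ k = R ^ k * (-1) ^ k * (1 - x / R) ^ k := by
      rw [← mul_pow, ← mul_pow]; congr 1; field_simp; ring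
    rw [this, ha, smul_eq_mul]
    ring
  have ha0 : ∀ k, 0 ≤ a k := by
    intro k
    rw [ha]
    exact mul_nonneg (by positivity) (hmono k R hR.le)
  have hT0 : 0 ≤ ∑ k ∈ Finset.range (n + 1), a k := Finset.sum_nonneg fun k _ => ha0 k
  have hmon : ∀ x, 0 ≤ x → MonotoneOn (fun t => g x - taylorWithinEval g n s t x) (Set.Ici x) := by
    intro x hx
    have hsub : Set.Ici x ⊆ s := Set.Ici_subset_Ici.2 hx
    refine monotoneOn_of_hasDerivWithinAt_nonneg (convex_Ici x)
      (fun y hy => ((hder x y (hsub hy)).mono hsub).continuousWithinAt)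
      (fun y hy => (hder x y (hsub (interior_subset hy))).mono (interior_subset.trans hsub)) ?_
    intro y hy
    have hy := interior_subset hy
    have : 0 ≤ y - x := sub_nonneg.2 hy
    exact mul_nonneg (by positivity) (hmono _ y (hsub hy))
  have hφ0 : ∀ x, 0 ≤ x → x ≤ R → 0 ≤ g x - ∑ k ∈ Finset.range (n + 1), a k * (1 - x / R) ^ k := by
    intro x hx hxR
    have := hmon x hx (Set.self_mem_Ici) hxR hxR
    simpa [hT] using this
  have h00 := hφ0 0 le_rfl hR.le
  simp only [zero_div, sub_zero, one_pow, mul_one] at h00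
  refine ⟨by linarith, fun x hx hxR => ?_⟩
  rw [abs_of_nonneg (hφ0 x hx hxR)]
  have hq : 0 ≤ 1 - x / R := by rw [sub_nonneg, div_le_one hR]; exact hxR
  have hcmp : MonotoneOn (fun t => (1 - x / R) ^ n * (g 0 - taylorWithinEval g n s t 0)
      - (g x - taylorWithinEval g n s t x)) (Set.Icc x R) := by
    have hsub : Set.Icc x R ⊆ s := fun y hy => hx.trans hy.1
    have hd : ∀ y ∈ s, _ := fun y hy => ((hder 0 y hy).const_mul ((1 - x / R) ^ n)).sub (hder x y hy)
    refine monotoneOn_of_hasDerivWithinAt_nonneg (convex_Icc x R)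
      (fun y hy => ((hd y (hsub hy)).mono hsub).continuousWithinAt)
      (fun y hy => (hd y (hsub (interior_subset hy))).mono (interior_subset.trans hsub)) ?_
    intro y hy
    have hy := interior_subset hy
    have h1 : 0 ≤ y - x := sub_nonneg.2 hy.1
    have h2 : y - x ≤ (1 - x / R) * (y - 0) := by
      have : x / R * y ≤ x := by
        rw [div_mul_eq_mul_div, div_le_iff₀ hR]
        exact mul_le_mul_of_nonneg_left hy.2 hx
      linarith
    have h3 : (y - x) ^ n ≤ (1 - x / R) ^ n * (y - 0) ^ n := by
      rw [← mul_pow]; exact pow_le_pow_left₀ h1 h2 n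
    have h4 := hmono (n + 1) y (hsub hy)
    rw [sub_nonneg, ← mul_assoc ((1 - x / R) ^ n)]
    refine mul_le_mul_of_nonneg_right ?_ h4
    rw [← mul_div_assoc]
    gcongr
  have h5 := hcmp (Set.left_mem_Icc.2 hxR) (Set.right_mem_Icc.2 hxR) hxR
  have h6 : 0 ≤ g 0 - taylorWithinEval g n s x 0 := by
    have := hmon 0 le_rfl (Set.self_mem_Ici) hx hx
    simpa using this
  simp only [hT, taylorWithinEval_self, sub_self, sub_zero, zero_div, one_pow, mul_one] at h5
  have h7 : 0 ≤ (1 - x / R) ^ n * (g 0 - taylorWithinEval g n s x 0) := by positivity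
  have h8 : 0 ≤ (1 - x / R) ^ n * ∑ k ∈ Finset.range (n + 1), a k := by positivity
  linarith

lemma cm_pow_exp (u : ℝ) (h0 : 0 ≤ u) (h1 : u ≤ 1) (k : ℕ) :
    |(1 - u) ^ k - Real.exp (-(k * u))| ≤ u := by
  have he : Real.exp (-(k * u)) = Real.exp (-u) ^ k := by
    rw [← Real.exp_nat_mul]; congr 1; ring
  rcases k with _ | k
  · simpa using h0
  have hle := Real.one_sub_le_exp_neg u
  have hb := Real.abs_exp_sub_one_sub_id_le (x := -u) (by rw [abs_neg, abs_of_nonneg h0]; exact h1)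
  have h2 : |1 - u - Real.exp (-u)| ≤ u ^ 2 := by
    rw [abs_sub_comm]
    calc _ = |Real.exp (-u) - 1 - -u| := by congr 1; ring
      _ ≤ _ := by simpa using hb
  have hmax : max |1 - u| |Real.exp (-u)| = Real.exp (-u) := by
    rw [abs_of_nonneg (by linarith), abs_of_pos (Real.exp_pos _), max_eq_right hle]
  have h3 := abs_pow_sub_pow_le (1 - u) (Real.exp (-u)) (k + 1)
  rw [he]
  refine h3.trans ?_
  rw [hmax, Nat.add_sub_cancel]
  have h4 := Real.mul_exp_neg_le_exp_neg_one (((k + 1 : ℕ) : ℝ) * u)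
  have h5 : Real.exp (-u) ^ k = Real.exp u * Real.exp (-(((k + 1 : ℕ) : ℝ) * u)) := by
    rw [← Real.exp_nat_mul, ← Real.exp_add]; congr 1; push_cast; ring
  rw [h5]
  calc |1 - u - Real.exp (-u)| * ((k + 1 : ℕ) : ℝ)
        * (Real.exp u * Real.exp (-(((k + 1 : ℕ) : ℝ) * u)))
      ≤ u ^ 2 * ((k + 1 : ℕ) : ℝ)
        * (Real.exp u * Real.exp (-(((k + 1 : ℕ) : ℝ) * u))) := by gcongr
    _ = u * Real.exp u * (((k + 1 : ℕ) : ℝ) * u * Real.exp (-(((k + 1 : ℕ) : ℝ) * u))) := by ring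
    _ ≤ u * Real.exp 1 * Real.exp (-1) := by gcongr
    _ = u := by rw [mul_assoc, ← Real.exp_add]; simp

lemma cm_approx (g : ℝ → ℝ)
    (hg : ContDiffOn ℝ (⊤ : ℕ∞) g (Set.Ici 0))
    (hmono : ∀ k : ℕ, ∀ t ∈ Set.Ici (0 : ℝ),
        0 ≤ (-1 : ℝ) ^ k * iteratedDerivWithin k g (Set.Ici 0) t)
    (ε M δ : ℝ) (hε : 0 < ε) (hM : ε ≤ M) (hδ : 0 < δ) :
    ∃ (N : ℕ) (a : ℕ → ℝ) (s : ℝ), (∀ k, 0 ≤ a k) ∧ 0 ≤ s ∧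
      ∀ x, ε ≤ x → x ≤ M →
        |g x - ∑ k ∈ Finset.range N, a k * Real.exp (-(k * (s * x)))| ≤ δ := by
  have hg0 : 0 ≤ g 0 := by simpa using hmono 0 0 Set.self_mem_Ici
  have hM0 : 0 < M := hε.trans_le hM
  obtain ⟨R, hRM, hR⟩ : ∃ R, M ≤ R ∧ g 0 * M / (δ / 2) ≤ R :=
    ⟨max M (g 0 * M / (δ / 2)), le_max_left _ _, le_max_right _ _⟩
  have hR0 : 0 < R := hM0.trans_le hRM
  have hR' : g 0 * (M / R) ≤ δ / 2 := by
    rw [div_le_iff₀ (by positivity)] at hR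
    rw [← mul_div_assoc, div_le_iff₀ hR0]; linarith
  have hq0 : 0 ≤ 1 - ε / R := by rw [sub_nonneg, div_le_one hR0]; linarith
  have hq1 : 1 - ε / R < 1 := by have : 0 < ε / R := by positivity
                                 linarith
  obtain ⟨n, hn⟩ : ∃ n : ℕ, (1 - ε / R) ^ n * g 0 < δ / 2 := by
    have := (tendsto_pow_atTop_nhds_zero_of_lt_one hq0 hq1).mul_const (g 0)
    rw [zero_mul] at this
    exact (this.eventually (gt_mem_nhds (half_pos hδ))).exists
  obtain ⟨hsum, hap⟩ := cm_taylor g hg hmono R hR0 _ rfl n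
  set a : ℕ → ℝ := fun k => R ^ k / (k.factorial) *
    ((-1) ^ k * iteratedDerivWithin k g (Set.Ici 0) R) with ha
  have ha0 : ∀ k, 0 ≤ a k := fun k => mul_nonneg (by positivity) (hmono k R hR0.le)
  refine ⟨n + 1, a, 1 / R, ha0, by positivity, fun x hx hxM => ?_⟩
  have hx0 : 0 ≤ x := hε.le.trans hx
  have hxR : x ≤ R := hxM.trans hRM
  have h1 := hap x hx0 hxR
  have hqx : 0 ≤ 1 - x / R := by rw [sub_nonneg, div_le_one hR0]; linarith
  have h2 : (1 - x / R) ^ n * g 0 ≤ (1 - ε / R) ^ n * g 0 := by gcongr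
  have h3 : |∑ k ∈ Finset.range (n + 1), a k * (1 - x / R) ^ k
      - ∑ k ∈ Finset.range (n + 1), a k * Real.exp (-(k * (1 / R * x)))| ≤ δ / 2 := by
    rw [← Finset.sum_sub_distrib]
    calc _ ≤ ∑ k ∈ Finset.range (n + 1), a k * (M / R) := by
          refine (Finset.abs_sum_le_sum_abs _ _).trans (Finset.sum_le_sum fun k _ => ?_)
          rw [← mul_sub, abs_mul, abs_of_nonneg (ha0 k)]
          refine mul_le_mul_of_nonneg_left ?_ (ha0 k)
          have := cm_pow_exp (x / R) (by positivity) ((div_le_one hR0).2 hxR) k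
          rw [one_div_mul_eq_div]
          exact this.trans (by gcongr)
      _ = (∑ k ∈ Finset.range (n + 1), a k) * (M / R) := by rw [Finset.sum_mul]
      _ ≤ g 0 * (M / R) := by gcongr
      _ ≤ _ := hR'
  have := abs_sub_le (g x) (∑ k ∈ Finset.range (n + 1), a k * (1 - x / R) ^ k)
    (∑ k ∈ Finset.range (n + 1), a k * Real.exp (-(k * (1 / R * x))))
  linarith

lemma cm_inner_pow {d n : ℕ} (x : Fin n → EuclideanSpace ℝ (Fin d)) (m : ℕ) :
    (Matrix.of fun i j => (inner ℝ (x i) (x j)) ^ m : Matrix (Fin n) (Fin n) ℝ).PosSemidef := by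
  induction m with
  | zero =>
    have h : (Matrix.of fun i j => (inner ℝ (x i) (x j)) ^ 0 : Matrix (Fin n) (Fin n) ℝ)
        = Matrix.gram ℝ (fun _ : Fin n => (1 : ℝ)) := by
      ext i j
      simp [Matrix.gram]
    rw [h]
    exact Matrix.posSemidef_gram ℝ _
  | succ m ih =>
    have h : (Matrix.of fun i j => (inner ℝ (x i) (x j)) ^ (m + 1) : Matrix (Fin n) (Fin n) ℝ)
        = Matrix.hadamard (Matrix.of fun i j => (inner ℝ (x i) (x j)) ^ m) (Matrix.gram ℝ x) := by
      ext i j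
      simp [Matrix.gram, pow_succ]
    rw [h]
    exact Matrix.PosSemidef.hadamard ih (Matrix.posSemidef_gram ℝ x)

lemma cm_gauss {d n : ℕ} (x : Fin n → EuclideanSpace ℝ (Fin d)) (c : Fin n → ℝ) (s : ℝ)
    (hs : 0 ≤ s) : 0 ≤ ∑ i, ∑ j, c i * c j * Real.exp (-(s * ‖x i - x j‖ ^ 2)) := by
  set b : Fin n → ℝ := fun i => c i * Real.exp (-(s * ‖x i‖ ^ 2)) with hb
  have key : ∀ i j, c i * c j * Real.exp (-(s * ‖x i - x j‖ ^ 2))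
      = b i * b j * Real.exp (2 * s * inner ℝ (x i) (x j)) := by
    intro i j
    have : Real.exp (-(s * ‖x i - x j‖ ^ 2)) = Real.exp (-(s * ‖x i‖ ^ 2))
        * Real.exp (-(s * ‖x j‖ ^ 2)) * Real.exp (2 * s * inner ℝ (x i) (x j)) := by
      rw [← Real.exp_add, ← Real.exp_add, norm_sub_sq_real]; congr 1; ring
    rw [this, hb]; ring
  simp only [key]
  have hsum : HasSum (fun m : ℕ => ∑ i, ∑ j, b i * b j *
      ((2 * s * inner ℝ (x i) (x j)) ^ m / m.factorial))
      (∑ i, ∑ j, b i * b j * Real.exp (2 * s * inner ℝ (x i) (x j))) := by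
    refine hasSum_sum fun i _ => hasSum_sum fun j _ => HasSum.mul_left _ ?_
    rw [Real.exp_eq_exp_ℝ]
    exact NormedSpace.expSeries_div_hasSum_exp _
  refine hsum.nonneg fun m => ?_
  have h := (cm_inner_pow x m).dotProduct_mulVec_nonneg b
  have h2 : ∑ i, ∑ j, b i * b j * ((2 * s * inner ℝ (x i) (x j)) ^ m / m.factorial)
      = (2 * s) ^ m / m.factorial * ∑ i, ∑ j, b i * b j * (inner ℝ (x i) (x j)) ^ m := by
    simp only [Finset.mul_sum]
    refine Finset.sum_congr rfl fun i _ => Finset.sum_congr rfl fun j _ => ?_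
    rw [mul_pow]; ring
  rw [h2]
  refine mul_nonneg (by positivity) ?_
  convert h using 1
  simp only [dotProduct, Matrix.mulVec, Matrix.of_apply, Finset.mul_sum, Pi.star_apply,
    star_trivial]
  refine Finset.sum_congr rfl fun i _ => Finset.sum_congr rfl fun j _ => ?_
  ring

/-- If `g` is infinitely differentiable on `[0, ∞)` and completely monotonic there,
then the radial kernel `κ(x, y) = g(‖x − y‖²)` on `ℝᵈ` is positive definite. -/
theorem radial_kernel_pos_def_of_completely_monotonic (g : ℝ → ℝ)
    (hg : ContDiffOn ℝ (⊤ : ℕ∞) g (Set.Ici 0))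
    (hmono : ∀ k : ℕ, ∀ t ∈ Set.Ici (0 : ℝ),
        0 ≤ (-1 : ℝ) ^ k * iteratedDerivWithin k g (Set.Ici 0) t) :
    ∀ (d n : ℕ) (x : Fin n → EuclideanSpace ℝ (Fin d)) (c : Fin n → ℝ),
      0 ≤ ∑ i, ∑ j, c i * c j * g (‖x i - x j‖ ^ 2) := by
  intro d n x c
  have hpos : ∀ ε : ℝ, 0 < ε → 0 ≤ ∑ i, ∑ j, c i * c j * g (ε + ‖x i - x j‖ ^ 2) := by
    intro ε hε
    set B : ℝ := ∑ i, ∑ j, |c i * c j| with hB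
    have hB0 : 0 ≤ B := Finset.sum_nonneg fun i _ => Finset.sum_nonneg fun j _ => abs_nonneg _
    set M : ℝ := ε + ∑ i, ∑ j, ‖x i - x j‖ ^ 2 with hMdef
    have hM : ∀ i j, ε + ‖x i - x j‖ ^ 2 ≤ M := by
      intro i j
      have h1 : ‖x i - x j‖ ^ 2 ≤ ∑ j, ‖x i - x j‖ ^ 2 :=
        Finset.single_le_sum (f := fun j => ‖x i - x j‖ ^ 2) (fun j _ => by positivity)
          (Finset.mem_univ j)
      have h2 : ∑ j, ‖x i - x j‖ ^ 2 ≤ ∑ i, ∑ j, ‖x i - x j‖ ^ 2 :=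
        Finset.single_le_sum (f := fun i => ∑ j, ‖x i - x j‖ ^ 2) (fun j _ => by positivity)
          (Finset.mem_univ i)
      linarith
    have hεM : ε ≤ M := by
      have : 0 ≤ ∑ i, ∑ j, ‖x i - x j‖ ^ 2 := by positivity
      linarith
    have hδ : ∀ δ : ℝ, 0 < δ → 0 ≤ ∑ i, ∑ j, c i * c j * g (ε + ‖x i - x j‖ ^ 2) + B * δ := by
      intro δ hδ
      obtain ⟨N, a, s, ha, hs, hap⟩ := cm_approx g hg hmono ε M δ hε hεM hδ
      have h1 : 0 ≤ ∑ i, ∑ j, c i * c j *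
          ∑ k ∈ Finset.range N, a k * Real.exp (-(k * (s * (ε + ‖x i - x j‖ ^ 2)))) := by
        have : ∑ i, ∑ j, c i * c j *
            ∑ k ∈ Finset.range N, a k * Real.exp (-(k * (s * (ε + ‖x i - x j‖ ^ 2))))
            = ∑ k ∈ Finset.range N, a k * Real.exp (-(k * s * ε)) *
              ∑ i, ∑ j, c i * c j * Real.exp (-(k * s * ‖x i - x j‖ ^ 2)) := by
          simp only [Finset.mul_sum]
          rw [Finset.sum_comm' (t' := Finset.univ) (s' := fun _ => Finset.range N) (by simp)]
          refine Finset.sum_congr rfl fun i _ => ?_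
          rw [Finset.sum_comm]
          refine Finset.sum_congr rfl fun k _ => Finset.sum_congr rfl fun j _ => ?_
          have : Real.exp (-(k * (s * (ε + ‖x i - x j‖ ^ 2))))
              = Real.exp (-(k * s * ε)) * Real.exp (-(k * s * ‖x i - x j‖ ^ 2)) := by
            rw [← Real.exp_add]; congr 1; ring
          rw [this]; ring
        rw [this]
        exact Finset.sum_nonneg fun k _ => mul_nonneg (mul_nonneg (ha k) (Real.exp_pos _).le)
          (cm_gauss x c _ (by positivity))
      refine h1.trans ?_
      rw [hB, Finset.sum_mul, ← Finset.sum_add_distrib]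
      refine Finset.sum_le_sum fun i _ => ?_
      rw [Finset.sum_mul, ← Finset.sum_add_distrib]
      refine Finset.sum_le_sum fun j _ => ?_
      have h2 := hap (ε + ‖x i - x j‖ ^ 2) (by have := sq_nonneg ‖x i - x j‖; linarith) (hM i j)
      set S := ∑ k ∈ Finset.range N, a k * Real.exp (-(k * (s * (ε + ‖x i - x j‖ ^ 2))))
      have h3 : |c i * c j * (g (ε + ‖x i - x j‖ ^ 2) - S)| ≤ |c i * c j| * δ := by
        rw [abs_mul]; gcongr
      have := (abs_le.1 h3).1
      linarith
    have hlim : Filter.Tendsto (fun δ : ℝ => ∑ i, ∑ j, c i * c j * g (ε + ‖x i - x j‖ ^ 2) + B * δ)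
        (nhdsWithin 0 (Set.Ioi 0))
        (nhds (∑ i, ∑ j, c i * c j * g (ε + ‖x i - x j‖ ^ 2) + B * 0)) :=
      ((continuous_const.add (continuous_const.mul continuous_id)).tendsto 0).mono_left
        nhdsWithin_le_nhds
    have := ge_of_tendsto hlim (by filter_upwards [self_mem_nhdsWithin] with δ h using hδ δ h)
    simpa using this
  have hlim : Filter.Tendsto (fun ε : ℝ => ∑ i, ∑ j, c i * c j * g (ε + ‖x i - x j‖ ^ 2))
      (nhdsWithin 0 (Set.Ioi 0)) (nhds (∑ i, ∑ j, c i * c j * g (‖x i - x j‖ ^ 2))) := by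
    refine tendsto_finsetSum _ fun i _ => tendsto_finsetSum _ fun j _ => ?_
    refine Filter.Tendsto.const_mul _ ?_
    have h0 : (0 : ℝ) ≤ ‖x i - x j‖ ^ 2 := by positivity
    have hc : ContinuousWithinAt g (Set.Ici 0) (‖x i - x j‖ ^ 2) := hg.continuousOn _ h0
    refine hc.tendsto.comp (tendsto_nhdsWithin_iff.2 ⟨?_, ?_⟩)
    · have : Filter.Tendsto (fun ε : ℝ => ε + ‖x i - x j‖ ^ 2) (nhds 0)
          (nhds (0 + ‖x i - x j‖ ^ 2)) :=
        (continuous_id.add continuous_const).tendsto 0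
      rw [zero_add] at this
      exact this.mono_left nhdsWithin_le_nhds
    · filter_upwards [self_mem_nhdsWithin] with ε h
      exact add_nonneg (le_of_lt h) h0
  exact ge_of_tendsto hlim (by filter_upwards [self_mem_nhdsWithin] with ε h using hpos ε h)
end
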